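/- A nonnegative integer n is represented by the quaternary quadratic form 2x₁² + 2x₁x₂ + 3x₂² + 20y₁² + 100y₂² if and only if n ≡ 0, 2 or 3 (mod 4) and n ≡ 0, 2 or 3 (mod 5). (This is the regularity of the binary Hermitian lattice [2, −1+ω; −1+ω̄, 3] ⊥ ⟨20⟩ over ℚ(√-5), stated for its associated quadratic form.) -/

import Mathlib

/-- The integral ternary form `a x² + b y² + c z² + 2 u y z + 2 v x z + 2 w x y`. -/
structure TernaryForm where
  (a b c u v w : ℤ)

namespace TernaryForm

def eval (q : TernaryForm) (x y z : ℤ) : ℤ :=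
  q.a * x ^ 2 + q.b * y ^ 2 + q.c * z ^ 2 + 2 * q.u * y * z + 2 * q.v * x * z + 2 * q.w * x * y

def det (q : TernaryForm) : ℤ :=
  q.a * q.b * q.c + 2 * q.u * q.v * q.w - q.a * q.u ^ 2 - q.b * q.v ^ 2 - q.c * q.w ^ 2

def Represents (q : TernaryForm) (n : ℤ) : Prop := ∃ x y z, q.eval x y z = n

def PosDef (q : TernaryForm) : Prop := ∀ x y z, q.eval x y z ≤ 0 → x = 0 ∧ y = 0 ∧ z = 0

def swapXY (q : TernaryForm) : TernaryForm := ⟨q.b, q.a, q.c, q.v, q.u, q.w⟩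

def swapYZ (q : TernaryForm) : TernaryForm := ⟨q.a, q.c, q.b, q.u, q.w, q.v⟩

/-- Replace the third basis vector `e₃` by `e₃ + s e₁ + t e₂`. -/
def shear (q : TernaryForm) (s t : ℤ) : TernaryForm :=
  ⟨q.a, q.b, q.c + s ^ 2 * q.a + t ^ 2 * q.b + 2 * s * q.v + 2 * t * q.u + 2 * s * t * q.w,
    q.u + t * q.b + s * q.w, q.v + s * q.a + t * q.w, q.w⟩

/-- Weak form of equivalence: the forms have equal determinants, represent the same integers, and
`r` inherits positive definiteness from `q`. -/
structure Similar (q r : TernaryForm) : Prop where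
  posDef : q.PosDef → r.PosDef
  det_eq : r.det = q.det
  represents : ∀ n, r.Represents n ↔ q.Represents n

theorem Similar.refl (q : TernaryForm) : q.Similar q := ⟨id, rfl, fun _ => Iff.rfl⟩

theorem Similar.trans {q r s : TernaryForm} (h : q.Similar r) (h' : r.Similar s) : q.Similar s :=
  ⟨h'.posDef ∘ h.posDef, h'.det_eq.trans h.det_eq,
    fun n => (h'.represents n).trans (h.represents n)⟩

theorem similar_swapXY (q : TernaryForm) : q.Similar q.swapXY := by
  have key : ∀ x y z, q.swapXY.eval x y z = q.eval y x z := fun x y z => by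
    simp only [swapXY, eval]; ring
  refine ⟨fun h x y z hx => ?_, by simp only [swapXY, det]; ring, fun n => ⟨?_, ?_⟩⟩
  · have := h y x z (by rwa [← key])
    tauto
  · rintro ⟨x, y, z, h⟩; exact ⟨y, x, z, by rw [← key, h]⟩
  · rintro ⟨x, y, z, h⟩; exact ⟨y, x, z, by rw [key, h]⟩

theorem similar_swapYZ (q : TernaryForm) : q.Similar q.swapYZ := by
  have key : ∀ x y z, q.swapYZ.eval x y z = q.eval x z y := fun x y z => by
    simp only [swapYZ, eval]; ring
  refine ⟨fun h x y z hx => ?_, by simp only [swapYZ, det]; ring, fun n => ⟨?_, ?_⟩⟩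
  · have := h x z y (by rwa [← key])
    tauto
  · rintro ⟨x, y, z, h⟩; exact ⟨x, z, y, by rw [← key, h]⟩
  · rintro ⟨x, y, z, h⟩; exact ⟨x, z, y, by rw [key, h]⟩

theorem similar_shear (q : TernaryForm) (s t : ℤ) : q.Similar (q.shear s t) := by
  have key : ∀ x y z, (q.shear s t).eval x y z = q.eval (x + s * z) (y + t * z) z :=
    fun x y z => by simp only [shear, eval]; ring
  refine ⟨fun h x y z hx => ?_, by simp only [shear, det]; ring, fun n => ⟨?_, ?_⟩⟩
  · obtain ⟨h1, h2, rfl⟩ := h _ _ _ ((key x y z).symm.trans_le hx)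
    simpa using And.intro h1 h2
  · rintro ⟨x, y, z, h⟩; exact ⟨_, _, _, by rw [← key, h]⟩
  · rintro ⟨x, y, z, h⟩
    exact ⟨x - s * z, y - t * z, z, by rw [key, ← h]; congr 1 <;> ring⟩

/-- Minkowski reduction conditions in rank three. -/
structure Reduced (q : TernaryForm) : Prop where
  a_pos : 0 < q.a
  a_le_b : q.a ≤ q.b
  b_le_c : q.b ≤ q.c
  two_w_le : |2 * q.w| ≤ q.a
  two_v_le : |2 * q.v| ≤ q.a
  two_u_le : |2 * q.u| ≤ q.b
  shear_le : ∀ s t : ℤ, |s| = 1 → |t| = 1 →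
    0 ≤ q.a + q.b + 2 * s * q.v + 2 * t * q.u + 2 * s * t * q.w

theorem PosDef.diag_pos {q : TernaryForm} (h : q.PosDef) : 0 < q.a ∧ 0 < q.b ∧ 0 < q.c := by
  refine ⟨?_, ?_, ?_⟩ <;> by_contra! h0
  · have := h 1 0 0 (by simpa [eval] using h0); simp at this
  · have := h 0 1 0 (by simpa [eval] using h0); simp at this
  · have := h 0 0 1 (by simpa [eval] using h0); simp at this

theorem exists_reduced (q : TernaryForm) (hq : q.PosDef) : ∃ r, q.Similar r ∧ r.Reduced := by
  induction hk : (3 * q.a + 2 * q.b + q.c).toNat using Nat.strong_induction_on generalizing q with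
  | _ k ih =>
  subst hk
  have descend : ∀ r, q.Similar r → 3 * r.a + 2 * r.b + r.c < 3 * q.a + 2 * q.b + q.c →
      ∃ r, q.Similar r ∧ r.Reduced := fun r hr hlt => by
    have := (hr.posDef hq).diag_pos
    obtain ⟨r', h1, h2⟩ := ih _ (by omega) r (hr.posDef hq) rfl
    exact ⟨r', hr.trans h1, h2⟩
  obtain ⟨ha, hb, hc⟩ := hq.diag_pos
  by_contra hcon
  have stay : ∀ r, q.Similar r → 3 * q.a + 2 * q.b + q.c ≤ 3 * r.a + 2 * r.b + r.c :=
    fun r hr => not_lt.1 fun hlt => hcon (descend r hr hlt)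
  have hsh : ∀ s t, 0 ≤ s ^ 2 * q.a + t ^ 2 * q.b + 2 * s * q.v + 2 * t * q.u + 2 * s * t * q.w :=
    fun s t => by
      have := stay _ (q.similar_shear s t)
      simp only [shear] at this
      linarith
  have hyz : ∀ s, 0 ≤ s ^ 2 * q.a + 2 * s * q.w := fun s => by
    have := stay _ ((q.similar_swapYZ.trans (similar_shear _ s 0)).trans (similar_swapYZ _))
    simp only [shear, swapYZ] at this
    linarith
  refine hcon ⟨q, .refl q, ha, ?_, ?_, ?_, ?_, ?_, fun s t hs ht => ?_⟩
  · have := stay _ q.similar_swapXY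
    simp only [swapXY] at this
    linarith
  · have := stay _ q.similar_swapYZ
    simp only [swapYZ] at this
    linarith
  · exact abs_le.2 ⟨by linarith [hyz 1], by linarith [hyz (-1)]⟩
  · exact abs_le.2 ⟨by linarith [hsh 1 0], by linarith [hsh (-1) 0]⟩
  · exact abs_le.2 ⟨by linarith [hsh 0 1], by linarith [hsh 0 (-1)]⟩
  · have := hsh s t
    rw [← sq_abs s, ← sq_abs t, hs, ht] at this
    linarith

theorem Reduced.mul_le {q : TernaryForm} (h : q.Reduced) : q.a * q.b * q.c ≤ 4 * q.det := by
  obtain ⟨ha, hab, hbc, hw, hv, hu, hs⟩ := h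
  obtain ⟨a, b, c, u, v, w⟩ := q
  simp only [det] at *
  have hb : 0 < b := ha.trans_le hab
  have hc : 0 < c := hb.trans_le hbc
  have hU := abs_nonneg (2 * u)
  have hV := abs_nonneg (2 * v)
  have hW := abs_nonneg (2 * w)
  have e : 4 * (a * b * c + 2 * u * v * w - a * u ^ 2 - b * v ^ 2 - c * w ^ 2) =
      4 * (a * b * c) + 8 * (u * v * w) - a * |2 * u| ^ 2 - b * |2 * v| ^ 2 - c * |2 * w| ^ 2 := by
    simp only [sq_abs]; ring
  have hprod : |2 * u| * |2 * v| * |2 * w| = |8 * (u * v * w)| := by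
    rw [← abs_mul, ← abs_mul]; congr 1; ring
  have hsum : 0 ≤ u * v * w ∨ |2 * u| + |2 * v| + |2 * w| ≤ a + b := by
    have h1 := hs 1 1 (by simp) (by simp)
    have h2 := hs 1 (-1) (by simp) (by simp)
    have h3 := hs (-1) 1 (by simp) (by simp)
    have h4 := hs (-1) (-1) (by simp) (by simp)
    rcases le_total 0 u with hu0 | hu0 <;> rcases le_total 0 v with hv0 | hv0 <;>
      rcases le_total 0 w with hw0 | hw0
    · left; positivity
    · right
      rw [abs_of_nonneg (by linarith), abs_of_nonneg (by linarith), abs_of_nonpos (by linarith)]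
      linarith
    · right
      rw [abs_of_nonneg (by linarith), abs_of_nonpos (by linarith), abs_of_nonneg (by linarith)]
      linarith
    · left; rw [mul_assoc]; exact mul_nonneg hu0 (mul_nonneg_of_nonpos_of_nonpos hv0 hw0)
    · right
      rw [abs_of_nonpos (by linarith), abs_of_nonneg (by linarith), abs_of_nonneg (by linarith)]
      linarith
    · left; exact mul_nonneg_of_nonpos_of_nonpos (mul_nonpos_of_nonpos_of_nonneg hu0 hv0) hw0
    · left; exact mul_nonneg (mul_nonneg_of_nonpos_of_nonpos hu0 hv0) hw0
    · right
      rw [abs_of_nonpos (by linarith), abs_of_nonpos (by linarith), abs_of_nonpos (by linarith)]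
      linarith
  rw [e]
  generalize |2 * u| = U at *
  generalize |2 * v| = V at *
  generalize |2 * w| = W at *
  have h1 : a * U ^ 2 ≤ a * b * U := by
    nlinarith [mul_nonneg (mul_nonneg ha.le hU) (sub_nonneg.2 hu)]
  have h2 : b * V ^ 2 ≤ a * b * V := by
    nlinarith [mul_nonneg (mul_nonneg hb.le hV) (sub_nonneg.2 hv)]
  have h3 : c * W ^ 2 ≤ a * c * W := by
    nlinarith [mul_nonneg (mul_nonneg hc.le hW) (sub_nonneg.2 hw)]
  have h4 : a * c * W ≤ a * b * c := by
    nlinarith [mul_nonneg (mul_nonneg ha.le hc.le) (sub_nonneg.2 (hw.trans hab))]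
  have hab0 := mul_pos ha hb
  rcases hsum with h | h
  · have h5 : a * b * U ≤ a * b * c := mul_le_mul_of_nonneg_left (hu.trans hbc) hab0.le
    have h6 : a * b * V ≤ a * b * c := mul_le_mul_of_nonneg_left (hv.trans (hab.trans hbc)) hab0.le
    linarith
  · have h5 : U * V ≤ b * a := mul_le_mul hu hv hV hb.le
    have h6 : U * V * W ≤ b * a * W := mul_le_mul_of_nonneg_right h5 hW
    have h7 : a * b * (U + V) ≤ a * b * (a + b - W) :=
      mul_le_mul_of_nonneg_left (by linarith) hab0.le
    have h8 : a * b * (a + b) ≤ a * b * (2 * c) := mul_le_mul_of_nonneg_left (by linarith) hab0.le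
    have h9 := neg_abs_le (8 * (u * v * w))
    nlinarith

set_option maxRecDepth 100000 in
set_option synthInstance.maxHeartbeats 400000 in
set_option synthInstance.maxSize 1000 in
theorem classify_det_five : ∀ a ∈ Finset.Icc (1 : ℤ) 2, ∀ b ∈ Finset.Icc a (20 / a),
    ∀ c ∈ Finset.Icc b (20 / (a * b)), ∀ u ∈ Finset.Icc (-(b / 2)) (b / 2),
    ∀ v ∈ Finset.Icc (-(a / 2)) (a / 2), ∀ w ∈ Finset.Icc (-(a / 2)) (a / 2),
    a * b * c + 2 * u * v * w - a * u ^ 2 - b * v ^ 2 - c * w ^ 2 = 5 →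
    0 ≤ a + b - 2 * v - 2 * u + 2 * w → 0 ≤ a + b + 2 * v - 2 * u - 2 * w →
    0 ≤ a + b - 2 * v + 2 * u - 2 * w → 0 ≤ a + b + 2 * v + 2 * u + 2 * w →
    a = 1 ∧ v = 0 ∧ w = 0 ∧ (b = 1 ∧ c = 5 ∧ u = 0 ∨ b = 2 ∧ c = 3 ∧ |u| = 1) := by
  decide +kernel

set_option maxRecDepth 100000 in
set_option synthInstance.maxHeartbeats 400000 in
set_option synthInstance.maxSize 1000 in
theorem classify_det_twenty : ∀ a ∈ Finset.Icc (1 : ℤ) 4, ∀ b ∈ Finset.Icc a (80 / a),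
    ∀ c ∈ Finset.Icc b (80 / (a * b)), ∀ u ∈ Finset.Icc (-(b / 2)) (b / 2),
    ∀ v ∈ Finset.Icc (-(a / 2)) (a / 2), ∀ w ∈ Finset.Icc (-(a / 2)) (a / 2),
    a * b * c + 2 * u * v * w - a * u ^ 2 - b * v ^ 2 - c * w ^ 2 = 20 →
    0 ≤ a + b - 2 * v - 2 * u + 2 * w → 0 ≤ a + b + 2 * v - 2 * u - 2 * w →
    0 ≤ a + b - 2 * v + 2 * u - 2 * w → 0 ≤ a + b + 2 * v + 2 * u + 2 * w →
    a % 4 ≠ 1 → b % 4 ≠ 1 → c % 4 ≠ 1 → (a + b + 2 * w) % 4 ≠ 1 → (a + c + 2 * v) % 4 ≠ 1 →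
    (b + c + 2 * u) % 4 ≠ 1 → (a + b + c + 2 * u + 2 * v + 2 * w) % 4 ≠ 1 →
    a % 2 = 1 ∨ b % 2 = 1 ∨ c % 2 = 1 →
    a = 2 ∧ b = 3 ∧ c = 4 ∧ u = 0 ∧ v = 0 ∧ |w| = 1 ∨
      a = 3 ∧ b = 3 ∧ c = 3 ∧ |u| = 1 ∧ |v| = 1 ∧ |w| = 1 := by
  decide +kernel

theorem Reduced.mem_Icc {q : TernaryForm} (h : q.Reduced) :
    q.b ∈ Finset.Icc q.a (4 * q.det / q.a) ∧ q.c ∈ Finset.Icc q.b (4 * q.det / (q.a * q.b)) ∧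
    q.u ∈ Finset.Icc (-(q.b / 2)) (q.b / 2) ∧ q.v ∈ Finset.Icc (-(q.a / 2)) (q.a / 2) ∧
    q.w ∈ Finset.Icc (-(q.a / 2)) (q.a / 2) ∧ q.a ^ 3 ≤ 4 * q.det := by
  have hle := h.mul_le
  obtain ⟨ha, hab, hbc, hw, hv, hu, -⟩ := h
  have hab0 := mul_pos ha (ha.trans_le hab)
  rw [abs_le] at hw hv hu
  simp only [Finset.mem_Icc]
  refine ⟨⟨hab, ?_⟩, ⟨hbc, ?_⟩, ⟨?_, ?_⟩, ⟨?_, ?_⟩, ⟨?_, ?_⟩, ?_⟩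
  · rw [Int.le_ediv_iff_mul_le ha]; nlinarith
  · rw [Int.le_ediv_iff_mul_le hab0]; linarith
  any_goals omega
  · calc q.a ^ 3 = q.a * q.a * q.a := by ring
      _ ≤ q.a * q.b * q.c := by gcongr; exact hab.trans hbc
      _ ≤ _ := hle

theorem Reduced.shear_le' {q : TernaryForm} (h : q.Reduced) :
    0 ≤ q.a + q.b - 2 * q.v - 2 * q.u + 2 * q.w ∧ 0 ≤ q.a + q.b + 2 * q.v - 2 * q.u - 2 * q.w ∧
    0 ≤ q.a + q.b - 2 * q.v + 2 * q.u - 2 * q.w ∧ 0 ≤ q.a + q.b + 2 * q.v + 2 * q.u + 2 * q.w := by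
  have h1 := h.shear_le 1 1 (by simp) (by simp)
  have h2 := h.shear_le 1 (-1) (by simp) (by simp)
  have h3 := h.shear_le (-1) 1 (by simp) (by simp)
  have h4 := h.shear_le (-1) (-1) (by simp) (by simp)
  refine ⟨?_, ?_, ?_, ?_⟩ <;> linarith

theorem exists_of_det_five {q : TernaryForm} (hq : q.PosDef) (hd : q.det = 5)
    (h25 : ∀ n, q.Represents n → n % 25 ≠ 5) {n : ℤ} (hn : q.Represents n) :
    ∃ x y z u : ℤ, |u| = 1 ∧ n = x ^ 2 + 2 * y ^ 2 + 3 * z ^ 2 + 2 * u * y * z := by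
  obtain ⟨r, hs, hr⟩ := q.exists_reduced hq
  have hrd := hs.det_eq.trans hd
  obtain ⟨hb, hc, hu, hv, hw, ha⟩ := hr.mem_Icc
  obtain ⟨h1, h2, h3, h4⟩ := hr.shear_le'
  rw [hrd] at hb hc ha
  have ha2 : r.a ≤ 2 := by
    by_contra! h
    have : (3 : ℤ) ^ 3 ≤ r.a ^ 3 := by gcongr; omega
    omega
  obtain ⟨e1, e2, e3, h⟩ := classify_det_five _ (Finset.mem_Icc.2 ⟨hr.a_pos, ha2⟩) _ hb _ hc _ hu
    _ hv _ hw hrd h1 h2 h3 h4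
  rcases h with ⟨e4, e5, e6⟩ | ⟨e4, e5, e6⟩
  · exact absurd (by norm_num) (h25 5 ((hs.represents 5).1 ⟨2, 1, 0, by simp [eval, *]⟩))
  · obtain ⟨x, y, z, rfl⟩ := (hs.represents n).2 hn
    exact ⟨x, y, z, r.u, e6, by simp [eval, *]⟩

theorem exists_of_det_twenty {q : TernaryForm} (hq : q.PosDef) (hd : q.det = 20)
    (h4 : ∀ n, q.Represents n → n % 4 ≠ 1) (hodd : ∃ n, q.Represents n ∧ n % 2 = 1)
    (htwo : ∃ n, q.Represents n ∧ n % 4 = 2) {n : ℤ} (hn : q.Represents n) :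
    ∃ x y z w : ℤ, |w| = 1 ∧ n = 2 * x ^ 2 + 3 * y ^ 2 + 4 * z ^ 2 + 2 * w * x * y := by
  obtain ⟨r, hs, hr⟩ := q.exists_reduced hq
  have hrd := hs.det_eq.trans hd
  obtain ⟨hb, hc, hu, hv, hw, ha⟩ := hr.mem_Icc
  obtain ⟨h1, h2, h3, h5⟩ := hr.shear_le'
  rw [hrd] at hb hc ha
  have ha4 : r.a ≤ 4 := by
    by_contra! h
    have : (5 : ℤ) ^ 3 ≤ r.a ^ 3 := by gcongr; omega
    omega
  have hval : ∀ x y z, r.eval x y z % 4 ≠ 1 := fun x y z =>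
    h4 _ ((hs.represents _).1 ⟨x, y, z, rfl⟩)
  have hdiag : r.a % 2 = 1 ∨ r.b % 2 = 1 ∨ r.c % 2 = 1 := by
    obtain ⟨m, hm, hm2⟩ := hodd
    obtain ⟨x, y, z, rfl⟩ := (hs.represents m).2 hm
    by_contra! hev
    obtain ⟨⟨a, ha⟩, ⟨b, hb⟩, ⟨c, hc⟩⟩ : 2 ∣ r.a ∧ 2 ∣ r.b ∧ 2 ∣ r.c := by omega
    have : r.eval x y z = 2 * (a * x ^ 2 + b * y ^ 2 + c * z ^ 2 + r.u * y * z + r.v * x * z +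
        r.w * x * y) := by
      simp only [eval, ha, hb, hc]; ring
    omega
  have h := classify_det_twenty _ (Finset.mem_Icc.2 ⟨hr.a_pos, ha4⟩) _ hb _ hc _ hu
    _ hv _ hw hrd h1 h2 h3 h5 (by simpa [eval] using hval 1 0 0) (by simpa [eval] using hval 0 1 0)
    (by simpa [eval] using hval 0 0 1) (by simpa [eval] using hval 1 1 0)
    (by simpa [eval] using hval 1 0 1) (by simpa [eval] using hval 0 1 1)
    (by simpa [eval] using hval 1 1 1) hdiag
  rcases h with ⟨e1, e2, e3, e4, e5, e6⟩ | ⟨e1, e2, e3, e4, e5, e6⟩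
  · obtain ⟨x, y, z, rfl⟩ := (hs.represents n).2 hn
    exact ⟨x, y, z, r.w, e6, by simp [eval, *]⟩
  · exfalso
    obtain ⟨m, hm, hm2⟩ := htwo
    obtain ⟨x, y, z, rfl⟩ := (hs.represents m).2 hm
    have key : ∀ a b c u v w x y z : ZMod 4, a = 3 → b = 3 → c = 3 → (u = 1 ∨ u = -1) →
        (v = 1 ∨ v = -1) → (w = 1 ∨ w = -1) →
        a * x ^ 2 + b * y ^ 2 + c * z ^ 2 + 2 * u * y * z + 2 * v * x * z + 2 * w * x * y ≠ 2 := by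
      rintro _ _ _ u v w x y z rfl rfl rfl (rfl | rfl) (rfl | rfl) (rfl | rfl) <;>
        revert x y z <;> decide
    have cast : ∀ t : ℤ, |t| = 1 → ((t : ZMod 4) = 1 ∨ (t : ZMod 4) = -1) := fun t ht => by
      rcases (abs_eq zero_le_one).1 ht with rfl | rfl <;> simp
    refine key r.a r.b r.c r.u r.v r.w x y z (by simp [e1]) (by simp [e2]) (by simp [e3])
      (cast _ e4) (cast _ e5) (cast _ e6) ?_
    have := (ZMod.intCast_eq_intCast_iff' (r.eval x y z) 2 4).2 hm2
    simpa [eval] using this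

end TernaryForm

theorem exists_of_five_mul {n m x y z w : ℤ} (hm : m % 5 = 1 ∨ m % 5 = 4) (hw : |w| = 1)
    (h : 5 * n = 2 * x ^ 2 + 3 * y ^ 2 + m * z ^ 2 + 2 * w * x * y) :
    ∃ x1 x2 y1 : ℤ, 2 * x1 ^ 2 + 2 * x1 * x2 + 3 * x2 ^ 2 + 5 * m * y1 ^ 2 = n := by
  have hw2 : w ^ 2 = 1 := by rw [← sq_abs, hw]; norm_num
  have h10 : (2 * x + w * y) ^ 2 + 2 * m * z ^ 2 = 5 * (2 * n - y ^ 2) := by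
    linear_combination (-2) * h + y ^ 2 * hw2
  obtain ⟨⟨t, ht⟩, ⟨s, rfl⟩⟩ : (5 : ℤ) ∣ 2 * x + w * y ∧ (5 : ℤ) ∣ z := by
    have key : ∀ a b m : ZMod 5, m = 1 ∨ m = 4 → a ^ 2 + 2 * m * b ^ 2 = 0 → a = 0 ∧ b = 0 := by
      decide
    have := key (2 * x + w * y : ℤ) z m
      (hm.imp (ZMod.intCast_eq_intCast_iff' m 1 5).2 (ZMod.intCast_eq_intCast_iff' m 4 5).2) (by
        have := congrArg (Int.cast : ℤ → ZMod 5) h10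
        have h5 : (5 : ZMod 5) = 0 := rfl
        push_cast at this ⊢
        rw [this, h5, zero_mul])
    exact this.imp (ZMod.intCast_zmod_eq_zero_iff_dvd _ 5).1
      (ZMod.intCast_zmod_eq_zero_iff_dvd _ 5).1
  obtain rfl : y = w * (5 * t - 2 * x) := by linear_combination w * ht - y * hw2
  refine ⟨w * (2 * t - x), w * t, s, ?_⟩
  have : 10 * (2 * (w * (2 * t - x)) ^ 2 + 2 * (w * (2 * t - x)) * (w * t) + 3 * (w * t) ^ 2 +
      5 * m * s ^ 2) = 10 * n := by
    linear_combination (-2) * h + 4 * x ^ 2 * hw2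
  linarith

/-- By the theorem of Dirichlet, `(M e - 2 ^ i) / 5` takes prime values for
`e ≡ e₀ (mod 5 * 2 ^ j)`. -/
theorem exists_prime_and_mul_eq {M e₀ c : ℤ} (i j : ℕ) (hM : 0 < M)
    (h₀ : M * e₀ = 5 * c + 2 ^ i) (hc : Odd c) :
    ∃ (p e : ℕ), p.Prime ∧ p ≠ 2 ∧ M * e = 5 * p + 2 ^ i ∧ (e : ℤ) ≡ e₀ [ZMOD 5 * 2 ^ j] := by
  have h2 : ∀ k, IsCoprime c (2 ^ k) := fun k => (Int.isCoprime_two_right.2 hc).pow_right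
  have hcM : IsCoprime c (2 ^ j * M) := by
    refine (h2 j).mul_right ?_
    obtain ⟨α, β, h⟩ := h2 i
    exact ⟨α - 5 * β, β * e₀, by linear_combination h + β * h₀⟩
  lift M to ℕ using hM.le
  obtain ⟨p, hp2, hp, hmod⟩ := Nat.forall_exists_prime_gt_and_zmodEq 2 (q := 2 ^ j * M) (a := c)
    (mul_ne_zero (by simp) (by omega)) (by simpa using hcM)
  obtain ⟨k, hk⟩ := hmod.symm.dvd
  have hMe : (M : ℤ) * (e₀ + 5 * 2 ^ j * k) = 5 * p + 2 ^ i := by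
    push_cast at hk
    linear_combination h₀ - 5 * hk
  have hpos : 0 < e₀ + 5 * 2 ^ j * k := by
    refine pos_of_mul_pos_right (a := (M : ℤ)) ?_ hM.le
    rw [hMe]; positivity
  lift e₀ + 5 * 2 ^ j * k to ℕ using hpos.le with e he
  exact ⟨p, e, hp, by omega, hMe, by rw [he]; simp [Int.ModEq]⟩

open NumberTheorySymbols in
/-- If `E` is a nonresidue mod 5, `E ≡ 1 (mod 4)` and `5p ≡ -r (mod E)` then `(E/p) = -(-r/E)`. -/
theorem jacobiSym_eq_neg {p E : ℕ} {r : ℤ} (hp : Odd p) (hE : E % 4 = 1)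
    (hE5 : E % 5 = 2 ∨ E % 5 = 3) (h : (E : ℤ) ∣ 5 * p + r) : J(E | p) = -J(-r | E) := by
  have hodd : Odd E := Nat.odd_iff.2 (by omega)
  have h5 : J((5 : ℕ) | E) = -1 := by
    rw [jacobiSym.quadratic_reciprocity_one_mod_four (by norm_num) hodd, jacobiSym.mod_left]
    rcases hE5 with h | h
    · rw [show ((E : ℤ) % (5 : ℕ)) = 2 by omega]; norm_num
    · rw [show ((E : ℤ) % (5 : ℕ)) = 3 by omega]; norm_num
  have h5p : J((5 : ℕ) * (p : ℤ) | E) = J(-r | E) :=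
    jacobiSym.mod_left' (Int.modEq_iff_dvd.2 (by rwa [sub_neg_eq_add])).symm
  rw [jacobiSym.mul_left, h5] at h5p
  rw [jacobiSym.quadratic_reciprocity_one_mod_four hE hp]
  linarith

theorem exists_dvd_sq_add {p : ℕ} (hp : p.Prime) {e : ℤ} (h : jacobiSym (-e) p = 1) :
    ∃ b : ℤ, (p : ℤ) ∣ b ^ 2 + e := by
  have := Fact.mk hp
  obtain ⟨x, hx⟩ := ZMod.isSquare_of_jacobiSym_eq_one h
  obtain ⟨b, rfl⟩ := ZMod.intCast_surjective x
  refine ⟨b, (ZMod.intCast_zmod_eq_zero_iff_dvd _ p).1 ?_⟩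
  push_cast at hx ⊢
  rw [sq, ← hx, neg_add_cancel]

namespace TernaryForm

/-- The form with Gram matrix `!![a, b, 5; b, c, 0; 5, 0, 5M]`, which represents `5M`. -/
def ofBinary (M a b c : ℤ) : TernaryForm := ⟨a, c, 5 * M, 0, 5, b⟩

theorem ofBinary_represents (M a b c : ℤ) : (ofBinary M a b c).Represents (5 * M) :=
  ⟨0, 0, 1, by simp [ofBinary, eval]⟩

theorem ofBinary_det (M a b c : ℤ) :
    (ofBinary M a b c).det = 5 * (M * (a * c - b ^ 2) - 5 * c) := by
  simp only [ofBinary, det]; ring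

theorem ofBinary_posDef {M a b c : ℤ} (hc : 0 < c) (he : 0 < a * c - b ^ 2)
    (hd : 0 < M * (a * c - b ^ 2) - 5 * c) : (ofBinary M a b c).PosDef := by
  intro x y z h
  set e := a * c - b ^ 2 with he'
  have key : e * (c * (ofBinary M a b c).eval x y z) = e * (c * y + b * x) ^ 2 +
      (e * x + 5 * c * z) ^ 2 + 5 * c * (M * e - 5 * c) * z ^ 2 := by
    simp only [ofBinary, eval, he']; ring
  have h0 : e * (c * (ofBinary M a b c).eval x y z) ≤ 0 :=
    mul_nonpos_of_nonneg_of_nonpos he.le (mul_nonpos_of_nonneg_of_nonpos hc.le h)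
  rw [key] at h0
  have p1 : 0 ≤ e * (c * y + b * x) ^ 2 := by positivity
  have p2 := sq_nonneg (e * x + 5 * c * z)
  have p3 : 0 ≤ 5 * c * (M * e - 5 * c) * z ^ 2 := by positivity
  have hz : z = 0 := by
    have : 5 * c * (M * e - 5 * c) * z ^ 2 = 0 := by linarith
    simpa [hc.ne', hd.ne'] using this
  subst hz
  have hx : x = 0 := by
    have : (e * x + 5 * c * 0) ^ 2 = 0 := by linarith
    simpa [he.ne'] using this
  subst hx
  have : e * (c * y + b * 0) ^ 2 = 0 := by linarith
  simpa [he.ne', hc.ne'] using this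

end TernaryForm

open TernaryForm

theorem exists_of_mod_four_eq_three {N : ℤ} (hN : 0 < N) (h4 : N % 4 = 3)
    (h5 : N % 5 = 2 ∨ N % 5 = 3) :
    ∃ x1 x2 y1 : ℤ, 2 * x1 ^ 2 + 2 * x1 * x2 + 3 * x2 ^ 2 + 20 * y1 ^ 2 = N := by
  obtain ⟨e₀, he₀, c, hc, hodd⟩ : ∃ e₀ : ℤ, (e₀ = 17 ∨ e₀ = 13) ∧
      ∃ c, N * e₀ = 5 * c + 2 ^ 2 ∧ c % 2 = 1 := by
    rcases h5 with h | h
    · exact ⟨17, by simp, (N * 17 - 4) / 5, by omega, by omega⟩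
    · exact ⟨13, by simp, (N * 13 - 4) / 5, by omega, by omega⟩
  obtain ⟨p, e, hp, hp2, hpe, hmod⟩ := exists_prime_and_mul_eq 2 2 hN hc (Int.odd_iff.2 hodd)
  have he4 : e % 4 = 1 := by simp only [Int.ModEq] at hmod; omega
  have he5 : e % 5 = 2 ∨ e % 5 = 3 := by simp only [Int.ModEq] at hmod; omega
  have hpo := hp.odd_of_ne_two hp2
  have hp4 : p % 4 = 3 := by
    obtain ⟨k, rfl⟩ : ∃ k : ℤ, N = 4 * k + 3 := ⟨N / 4, by omega⟩
    obtain ⟨l, hl⟩ : ∃ l : ℤ, (e : ℤ) = 4 * l + 1 := ⟨e / 4, by omega⟩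
    rw [hl] at hpe
    ring_nf at hpe
    omega
  have hodd_e : Odd e := Nat.odd_iff.2 (by omega)
  have hJ : jacobiSym (-e) p = 1 := by
    rw [jacobiSym.neg _ hpo, ZMod.χ₄_nat_three_mod_four hp4,
      jacobiSym_eq_neg hpo he4 he5 (r := 4) ⟨N, by linarith⟩, jacobiSym.neg _ hodd_e,
      ZMod.χ₄_nat_one_mod_four he4, jacobiSym.at_four hodd_e]
    norm_num
  obtain ⟨b, a, hab⟩ := exists_dvd_sq_add hp hJ
  have he : a * p - b ^ 2 = e := by linarith
  have hdet : N * (a * p - b ^ 2) - 5 * p = 4 := by rw [he]; linarith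
  have hval : ∀ n, (ofBinary N a b p).Represents n → n % 4 ≠ 1 := by
    rintro _ ⟨x, y, z, rfl⟩ h1
    have key : ∀ a b x y z p N e : ZMod 4, p = 3 → N = 3 → e = 1 → a * p - b ^ 2 = e →
        a * x ^ 2 + p * y ^ 2 + 5 * N * z ^ 2 + 10 * x * z + 2 * b * x * y ≠ 1 := by
      rintro a b x y z _ _ _ rfl rfl rfl
      revert a b x y z
      decide
    refine key a b x y z p N e ((ZMod.natCast_eq_natCast_iff' p 3 4).2 hp4)
      ((ZMod.intCast_eq_intCast_iff' N 3 4).2 h4) (by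
        simpa using (ZMod.natCast_eq_natCast_iff' e 1 4).2 he4) (by exact_mod_cast congrArg _ he) ?_
    simpa [ofBinary, eval] using (ZMod.intCast_eq_intCast_iff' _ 1 4).2 h1
  obtain ⟨x, y, z, w, hw, h⟩ := exists_of_det_twenty
    (ofBinary_posDef (by exact_mod_cast hp.pos) (by rw [he]; omega) (by rw [hdet]; norm_num))
    (by rw [ofBinary_det, hdet]; norm_num) hval
    ⟨p, ⟨0, 1, 0, by simp [ofBinary, eval]⟩, by omega⟩
    ⟨p + 5 * N, ⟨0, 1, 1, by simp [ofBinary, eval]⟩, by omega⟩ (ofBinary_represents N a b p)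
  exact exists_of_five_mul (m := 4) (by norm_num) hw h

theorem exists_of_mod_four_eq_two {N : ℤ} (hN : 0 < N) (h4 : N % 4 = 2)
    (h5 : N % 5 = 2 ∨ N % 5 = 3) :
    ∃ x1 x2 y1 : ℤ, 2 * x1 ^ 2 + 2 * x1 * x2 + 3 * x2 ^ 2 + 20 * y1 ^ 2 = N := by
  obtain ⟨m, rfl⟩ : ∃ m, N = 2 * m := ⟨N / 2, by omega⟩
  obtain ⟨e₀, he₀5, he₀8, c, hc, hodd⟩ : ∃ e₀ : ℤ, (e₀ % 5 = 2 ∨ e₀ % 5 = 3) ∧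
      (m % 4 = 1 ∧ e₀ % 8 = 1 ∨ m % 4 = 3 ∧ e₀ % 8 = 5) ∧
      ∃ c, m * e₀ = 5 * c + 2 ^ 1 ∧ c % 2 = 1 := by
    have : m % 4 = 1 ∨ m % 4 = 3 := by omega
    rcases this with h | h <;> rcases h5 with h' | h'
    · exact ⟨17, by simp, by omega, (m * 17 - 2) / 5, by omega, by omega⟩
    · exact ⟨33, by simp, by omega, (m * 33 - 2) / 5, by omega, by omega⟩
    · exact ⟨37, by simp, by omega, (m * 37 - 2) / 5, by omega, by omega⟩
    · exact ⟨13, by simp, by omega, (m * 13 - 2) / 5, by omega, by omega⟩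
  obtain ⟨p, e, hp, hp2, hpe, hmod⟩ :=
    exists_prime_and_mul_eq 1 3 (by omega : 0 < m) hc (Int.odd_iff.2 hodd)
  have he8 : m % 4 = 1 ∧ e % 8 = 1 ∨ m % 4 = 3 ∧ e % 8 = 5 := by
    simp only [Int.ModEq] at hmod; omega
  have he4 : e % 4 = 1 := by omega
  have he5 : e % 5 = 2 ∨ e % 5 = 3 := by simp only [Int.ModEq] at hmod; omega
  have hpo := hp.odd_of_ne_two hp2
  have hpe8 : p % 4 = 3 ∧ e % 8 = 1 ∨ p % 4 = 1 ∧ e % 8 = 5 := by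
    obtain ⟨k, hk⟩ : ∃ k : ℤ, m = 4 * k + m % 4 := ⟨m / 4, by omega⟩
    obtain ⟨l, hl⟩ : ∃ l : ℤ, (e : ℤ) = 4 * l + 1 := ⟨e / 4, by omega⟩
    rw [hl, hk] at hpe
    rcases he8 with ⟨h, h'⟩ | ⟨h, h'⟩ <;> rw [h] at hpe <;> ring_nf at hpe <;> omega
  have hodd_e : Odd e := Nat.odd_iff.2 (by omega)
  have hJ : jacobiSym (-e) p = 1 := by
    rw [jacobiSym.neg _ hpo, jacobiSym_eq_neg hpo he4 he5 (r := 2) ⟨m, by linarith⟩,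
      jacobiSym.at_neg_two hodd_e, ZMod.χ₈'_nat_eq_if_mod_eight]
    rcases hpe8 with ⟨h, h'⟩ | ⟨h, h'⟩
    · rw [ZMod.χ₄_nat_three_mod_four h]
      simp [h', show e % 2 = 1 by omega]
    · rw [ZMod.χ₄_nat_one_mod_four h]
      simp [h', show e % 2 = 1 by omega]
  obtain ⟨b, hb, hbp⟩ : ∃ b : ℤ, b % 2 = 1 ∧ (p : ℤ) ∣ b ^ 2 + e := by
    obtain ⟨b, hb⟩ := exists_dvd_sq_add hp hJ
    rcases Int.emod_two_eq_zero_or_one b with h | h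
    · have := Nat.odd_iff.1 hpo
      obtain ⟨k, hk⟩ := hb
      exact ⟨b + p, by omega, k + 2 * b + p, by linear_combination hk⟩
    · exact ⟨b, h, hb⟩
  have hb8 : b ^ 2 % 8 = 1 := by
    have : b % 8 = 1 ∨ b % 8 = 3 ∨ b % 8 = 5 ∨ b % 8 = 7 := by omega
    rcases this with h | h | h | h <;> simp [pow_two, Int.mul_emod, h]
  obtain ⟨a, hab⟩ : 2 * (p : ℤ) ∣ b ^ 2 + e :=
    IsCoprime.mul_dvd (Int.isCoprime_two_left.2 (by exact_mod_cast hpo)) (by omega) hbp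
  have he : a * (2 * p) - b ^ 2 = e := by linarith
  have ha : a % 4 = 3 := by
    have hap : p * a % 4 = 1 ∧ p % 4 = 3 ∨ p * a % 4 = 3 ∧ p % 4 = 1 := by
      rw [mul_assoc] at hab; omega
    rcases hap with ⟨h, h'⟩ | ⟨h, h'⟩ <;> rw [Int.mul_emod] at h <;>
      rw [show (p : ℤ) % 4 = (p % 4 : ℕ) by simp, h'] at h <;> omega
  have hdet : 2 * m * (a * (2 * p) - b ^ 2) - 5 * (2 * p) = 4 := by rw [he]; linarith
  have hval : ∀ n, (ofBinary (2 * m) a b (2 * p)).Represents n → n % 4 ≠ 1 := by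
    rintro _ ⟨x, y, z, rfl⟩ h1
    have key : ∀ a b x y z c N : ZMod 4, a = 3 → (b = 1 ∨ b = 3) → c = 2 → N = 2 →
        a * x ^ 2 + c * y ^ 2 + 5 * N * z ^ 2 + 10 * x * z + 2 * b * x * y ≠ 1 := by
      rintro _ _ x y z _ _ rfl (rfl | rfl) rfl rfl <;> revert x y z <;> decide
    refine key a b x y z (2 * p : ℤ) (2 * m : ℤ) ((ZMod.intCast_eq_intCast_iff' a 3 4).2 ha)
      ((by omega : b % 4 = 1 ∨ b % 4 = 3).imp (ZMod.intCast_eq_intCast_iff' b 1 4).2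
        (ZMod.intCast_eq_intCast_iff' b 3 4).2)
      ((ZMod.intCast_eq_intCast_iff' _ 2 4).2 (by omega))
      ((ZMod.intCast_eq_intCast_iff' _ 2 4).2 h4) ?_
    simpa [ofBinary, eval] using (ZMod.intCast_eq_intCast_iff' _ 1 4).2 h1
  obtain ⟨x, y, z, w, hw, h⟩ := exists_of_det_twenty
    (ofBinary_posDef (by have := hp.pos; positivity) (by rw [he]; omega)
      (by rw [hdet]; norm_num))
    (by rw [ofBinary_det, hdet]; norm_num) hval
    ⟨a, ⟨1, 0, 0, by simp [ofBinary, eval]⟩, by omega⟩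
    ⟨2 * p, ⟨0, 1, 0, by simp [ofBinary, eval]⟩, by omega⟩ (ofBinary_represents (2 * m) a b (2 * p))
  exact exists_of_five_mul (m := 4) (by norm_num) hw h

theorem exists_add_five_mul_sq {M : ℤ} (hM : 0 < M) (h5 : M % 5 = 2 ∨ M % 5 = 3) :
    ∃ x1 x2 y1 : ℤ, 2 * x1 ^ 2 + 2 * x1 * x2 + 3 * x2 ^ 2 + 5 * y1 ^ 2 = M := by
  obtain ⟨e₀, he₀, c, hc, hodd⟩ : ∃ e₀ : ℤ, (e₀ = 68 ∨ e₀ = 52) ∧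
      ∃ c, M * e₀ = 5 * c + 2 ^ 0 ∧ c % 2 = 1 := by
    rcases h5 with h | h
    · exact ⟨68, by simp, (M * 68 - 1) / 5, by omega, by omega⟩
    · exact ⟨52, by simp, (M * 52 - 1) / 5, by omega, by omega⟩
  obtain ⟨p, e, hp, hp2, hpe, hmod⟩ := exists_prime_and_mul_eq 0 4 hM hc (Int.odd_iff.2 hodd)
  obtain ⟨E, rfl⟩ : 4 ∣ e := by simp only [Int.ModEq] at hmod; omega
  have hE4 : E % 4 = 1 := by simp only [Int.ModEq] at hmod; omega
  have hE5 : E % 5 = 2 ∨ E % 5 = 3 := by simp only [Int.ModEq] at hmod; omega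
  have hpo := hp.odd_of_ne_two hp2
  push_cast at hpe
  have hp4 : p % 4 = 3 := by
    rw [mul_left_comm] at hpe
    omega
  have hodd_E : Odd E := Nat.odd_iff.2 (by omega)
  have hJ : jacobiSym (-E) p = 1 := by
    rw [jacobiSym.neg _ hpo, ZMod.χ₄_nat_three_mod_four hp4,
      jacobiSym_eq_neg hpo hE4 hE5 (r := 1) ⟨4 * M, by linarith⟩, jacobiSym.at_neg_one hodd_E,
      ZMod.χ₄_nat_one_mod_four hE4]
    norm_num
  obtain ⟨b, a, hab⟩ := exists_dvd_sq_add hp hJ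
  have he : 4 * a * p - (2 * b) ^ 2 = 4 * E := by linarith
  have hdet : M * (4 * a * p - (2 * b) ^ 2) - 5 * p = 1 := by rw [he]; linarith
  have hval : ∀ n, (ofBinary M (4 * a) (2 * b) p).Represents n → n % 25 ≠ 5 := by
    rintro _ ⟨x, y, z, rfl⟩ h1
    have key : ∀ a b p : ZMod 5, (a * p - b ^ 2 = 2 ∨ a * p - b ^ 2 = 3) →
        ∀ x y, a * x ^ 2 + p * y ^ 2 + 2 * b * x * y = 0 → x = 0 ∧ y = 0 := by decide
    have h0 : (5 : ZMod 5) = 0 := rfl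
    have hxy := key (4 * a : ℤ) (2 * b : ℤ) p (by
      have hz : (((4 * a * p - (2 * b) ^ 2 : ℤ)) : ZMod 5) = ((4 * E : ℤ) : ZMod 5) := by rw [he]
      push_cast at hz ⊢
      rw [hz]
      rcases hE5 with h | h
      · right; rw [(ZMod.natCast_eq_natCast_iff' E 2 5).2 h]; rfl
      · left; rw [(ZMod.natCast_eq_natCast_iff' E 3 5).2 h]; rfl) x y (by
      have := (ZMod.intCast_eq_intCast_iff' ((ofBinary M (4 * a) (2 * b) p).eval x y z) 0 5).2
        (by omega)
      simp only [ofBinary, eval] at this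
      push_cast at this ⊢
      linear_combination this - (M * z ^ 2 + 2 * x * z) * h0)
    obtain ⟨⟨x, rfl⟩, ⟨y, rfl⟩⟩ := hxy.imp (ZMod.intCast_zmod_eq_zero_iff_dvd _ 5).1
      (ZMod.intCast_zmod_eq_zero_iff_dvd _ 5).1
    have hMz : M * z ^ 2 % 5 = 1 := by
      have : (ofBinary M (4 * a) (2 * b) p).eval (5 * x) (5 * y) z = 25 * (4 * a * x ^ 2 + p * y ^ 2
          + 4 * b * x * y + 2 * x * z) + 5 * (M * z ^ 2) := by
        simp only [ofBinary, eval]; ring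
      simp only [Nat.cast_ofNat] at h1
      omega
    have : z % 5 = 0 ∨ z % 5 = 1 ∨ z % 5 = 2 ∨ z % 5 = 3 ∨ z % 5 = 4 := by omega
    rcases h5 with h | h <;> rcases this with h' | h' | h' | h' | h' <;>
      simp [Int.mul_emod, pow_two, h, h'] at hMz
  obtain ⟨x, y, z, w, hw, h⟩ := exists_of_det_five
    (ofBinary_posDef (by exact_mod_cast hp.pos) (by rw [he]; omega) (by rw [hdet]; norm_num))
    (by rw [ofBinary_det, hdet]; norm_num) hval (ofBinary_represents M (4 * a) (2 * b) p)
  obtain ⟨x1, x2, y1, h'⟩ := exists_of_five_mul (n := M) (m := 1) (x := y) (y := z) (z := x)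
    (by norm_num) hw (by linarith)
  exact ⟨x1, x2, y1, by linarith⟩

theorem exists_add_twenty_mul_sq {N : ℤ} (hN : 0 < N) (h4 : N % 4 ≠ 1)
    (h5 : N % 5 = 2 ∨ N % 5 = 3) :
    ∃ x1 x2 y1 : ℤ, 2 * x1 ^ 2 + 2 * x1 * x2 + 3 * x2 ^ 2 + 20 * y1 ^ 2 = N := by
  have : N % 4 = 0 ∨ N % 4 = 2 ∨ N % 4 = 3 := by omega
  rcases this with h | h | h
  · obtain ⟨x, y, z, h'⟩ := exists_add_five_mul_sq (M := N / 4) (by omega) (by omega)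
    refine ⟨2 * x, 2 * y, z, ?_⟩
    have : N = 4 * (N / 4) := by omega
    rw [this, ← h']
    ring
  · exact exists_of_mod_four_eq_two hN h h5
  · exact exists_of_mod_four_eq_three hN h h5

theorem exists_add_four_mul_sq_add_twenty_mul_sq (M : ℤ) (hM : 0 ≤ M) (h4 : M % 4 ≠ 1) :
    ∃ x y z w : ℤ, 2 * x ^ 2 + 2 * x * y + 3 * y ^ 2 + 4 * z ^ 2 + 20 * w ^ 2 = M := by
  induction hk : M.toNat using Nat.strong_induction_on generalizing M with
  | _ k ih =>
  subst hk
  have of_sub : ∀ z : ℤ, 4 * z ^ 2 < M → ((M - 4 * z ^ 2) % 5 = 2 ∨ (M - 4 * z ^ 2) % 5 = 3) →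
      ∃ x y z w : ℤ, 2 * x ^ 2 + 2 * x * y + 3 * y ^ 2 + 4 * z ^ 2 + 20 * w ^ 2 = M :=
    fun z hz hz5 => by
      obtain ⟨x, y, w, h⟩ := exists_add_twenty_mul_sq (N := M - 4 * z ^ 2) (by omega) (by omega) hz5
      exact ⟨x, y, z, w, by linarith⟩
  have : M % 5 = 0 ∨ M % 5 = 1 ∨ M % 5 = 4 ∨ M % 5 = 2 ∨ M % 5 = 3 := by omega
  rcases this with h | h | h | h
  · rcases hM.eq_or_lt with rfl | hpos
    · exact ⟨0, 0, 0, 0, by norm_num⟩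
    · obtain ⟨x, y, z, w, h'⟩ := ih (M / 5).toNat (by omega) (M / 5) (by omega) (by omega) rfl
      -- `5 (2x² + 2xy + 3y²) = 2X² + 2XY + 3Y²` with `X = 2y - x`, `Y = 2x + y`
      refine ⟨2 * y - x, 2 * x + y, 5 * w, z, ?_⟩
      have : M = 5 * (M / 5) := by omega
      rw [this, ← h']
      ring
  · exact of_sub 1 (by omega) (by omega)
  · rcases lt_or_ge 16 M with h16 | h16
    · exact of_sub 2 (by omega) (by omega)
    · obtain rfl | rfl : M = 4 ∨ M = 14 := by omega
      · exact ⟨0, 0, 1, 0, by norm_num⟩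
      · exact ⟨-1, 2, 1, 0, by norm_num⟩
  · refine of_sub 0 (by omega) (by simpa using h)

theorem stmt_14 (n : ℤ) (hn : 0 ≤ n) :
    (∃ x1 x2 y1 y2 : ℤ, 2*x1^2 + 2*x1*x2 + 3*x2^2 + 20*y1^2 + 100*y2^2 = n) ↔
    ((n % 4 = 0 ∨ n % 4 = 2 ∨ n % 4 = 3) ∧ (n % 5 = 0 ∨ n % 5 = 2 ∨ n % 5 = 3)) := by
  constructor
  · rintro ⟨x, y, z, w, rfl⟩
    constructor
    · have key : ∀ x y : ZMod 4, 2 * x ^ 2 + 2 * x * y + 3 * y ^ 2 ≠ 1 := by decide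
      have : (2 * x ^ 2 + 2 * x * y + 3 * y ^ 2) % 4 ≠ 1 := fun h => key x y (by
        simpa using (ZMod.intCast_eq_intCast_iff' _ 1 4).2 h)
      omega
    · have key : ∀ x y : ZMod 5, 2 * x ^ 2 + 2 * x * y + 3 * y ^ 2 ≠ 1 ∧
          2 * x ^ 2 + 2 * x * y + 3 * y ^ 2 ≠ 4 := by decide
      have h1 : (2 * x ^ 2 + 2 * x * y + 3 * y ^ 2) % 5 ≠ 1 := fun h => (key x y).1 (by
        simpa using (ZMod.intCast_eq_intCast_iff' _ 1 5).2 h)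
      have h4 : (2 * x ^ 2 + 2 * x * y + 3 * y ^ 2) % 5 ≠ 4 := fun h => (key x y).2 (by
        simpa using (ZMod.intCast_eq_intCast_iff' _ 4 5).2 h)
      omega
  · rintro ⟨h4, h5 | h5⟩
    · obtain ⟨x, y, z, w, h⟩ := exists_add_four_mul_sq_add_twenty_mul_sq (n / 5) (by omega)
        (by omega)
      refine ⟨2 * y - x, 2 * x + y, z, w, ?_⟩
      have : n = 5 * (n / 5) := by omega
      rw [this, ← h]
      ring
    · obtain ⟨x, y, z, h⟩ := exists_add_twenty_mul_sq (N := n) (by omega) (by omega) h5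
      exact ⟨x, y, z, 0, by linarith⟩
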